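/- Let Σ_V be the bouquet shift with a(1) = 1 and a(n) = 2^n for n ≥ 2. Fix β > 2 and C = 1/ζ(β), where ζ is the Riemann zeta function, and define φ : Σ_V → ℝ by φ = log C on [rr], φ = log C − n log 2 − β log n on each 2-cylinder [r v_1^{n,i}] for n ≥ 2 and 1 ≤ i ≤ a(n), and φ = 0 elsewhere. Then: (i) P(φ) = 0 and φ is positive recurrent; (ii) the entropy at infinity satisfies h_∞ = log 2; (iii) δ_{φ,∞} = −log 2, hence δ_{φ,∞} + h_∞ = 0 = P(φ); (iv) Z_1^*(φ,r) = C and Z_n^*(φ,r) = C·n^{−β} for n ≥ 2, so limsup_{n→∞}(1/n)log Z_n^*(φ,r) = 0 = P(φ) and φ is not strongly positive recurrent; (v) χ_per(φ) < 0 = P(φ), so condition (UCS) holds. In particular, the hypothesis δ_{φ,∞} + h_∞ < P(φ) cannot be removed from the implication '(CI) and δ_{φ,∞} + h_∞ < P(φ) imply SPR'. -/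

import Mathlib

open Filter Set MeasureTheory Real ENNReal

namespace CMS

/-- Points of the full sequence space over the alphabet `ℕ`. -/
abbrev Pt : Type := ℕ → ℕ

/-- The (left) shift map `σ`. -/
def shiftMap : Pt → Pt := fun x i => x (i + 1)

/-- `x` is a point of the countable Markov shift `Σ` determined by the
transition matrix `M` (identified with a relation on the alphabet `ℕ`). -/
def isAdmissible (M : ℕ → ℕ → Prop) (x : Pt) : Prop := ∀ i, M (x i) (x (i + 1))

/-- Topological transitivity: for all states `a, b` there is `N` with
`[a] ∩ σ⁻ᴺ [b] ≠ ∅`. -/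
def TopTransitive (M : ℕ → ℕ → Prop) : Prop :=
  ∀ a b : ℕ, ∃ (N : ℕ) (x : Pt), isAdmissible M x ∧ x 0 = a ∧ x N = b

/-- Birkhoff sum `S_n φ`. -/
noncomputable def birkhoff (φ : Pt → ℝ) (n : ℕ) (x : Pt) : ℝ :=
  ∑ i ∈ Finset.range n, φ (shiftMap^[i] x)

/-- `φ` has summable variations: `∑_{k ≥ 2} var_k(φ) < ∞`, expressed via a summable
sequence dominating the `k`-th variations. -/
def SummableVariations (M : ℕ → ℕ → Prop) (φ : Pt → ℝ) : Prop :=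
  ∃ V : ℕ → ℝ, Summable V ∧
    ∀ k, 2 ≤ k → ∀ x y : Pt, isAdmissible M x → isAdmissible M y →
      (∀ i < k, x i = y i) → |φ x - φ y| ≤ V k

/-- `φ` is weakly Hölder continuous: `var_k(φ) ≤ C θ^k` for all `k ≥ 2`. -/
def WeaklyHolder (M : ℕ → ℕ → Prop) (φ : Pt → ℝ) : Prop :=
  ∃ C θ : ℝ, 0 < C ∧ 0 < θ ∧ θ < 1 ∧
    ∀ k, 2 ≤ k → ∀ x y : Pt, isAdmissible M x → isAdmissible M y →
      (∀ i < k, x i = y i) → |φ x - φ y| ≤ C * θ ^ k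

/-- Periodic points of period `n` in the 1-cylinder `[a]`. -/
def PerSet (M : ℕ → ℕ → Prop) (a n : ℕ) : Set Pt :=
  {x | isAdmissible M x ∧ shiftMap^[n] x = x ∧ x 0 = a}

/-- Periodic points of period `n` in `[a]` whose first return time to `[a]` is `n`. -/
def PerStarSet (M : ℕ → ℕ → Prop) (a n : ℕ) : Set Pt :=
  {x | isAdmissible M x ∧ shiftMap^[n] x = x ∧ x 0 = a ∧ ∀ k, 0 < k → k < n → x k ≠ a}

/-- The Gurevich partition function `Z_n(φ, a)`. -/
noncomputable def Zn (M : ℕ → ℕ → Prop) (φ : Pt → ℝ) (a n : ℕ) : ℝ≥0∞ :=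
  ∑' x : PerSet M a n, ENNReal.ofReal (Real.exp (birkhoff φ n x.1))

/-- The first-return partition function `Z_n^*(φ, a)`. -/
noncomputable def ZnStar (M : ℕ → ℕ → Prop) (φ : Pt → ℝ) (a n : ℕ) : ℝ≥0∞ :=
  ∑' x : PerStarSet M a n, ENNReal.ofReal (Real.exp (birkhoff φ n x.1))

/-- The Gurevich pressure at the state `a`:
`P(φ) = limsup_n (1/n) log Z_n(φ, a)`, with values in `EReal`. -/
noncomputable def pressureAt (M : ℕ → ℕ → Prop) (φ : Pt → ℝ) (a : ℕ) : EReal :=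
  Filter.limsup (fun n : ℕ => ((n : ℝ)⁻¹ : EReal) * ENNReal.log (Zn M φ a n)) atTop

/-- `limsup_n (1/n) log Z_n^*(φ, a)`, with values in `EReal`. -/
noncomputable def pressureStarAt (M : ℕ → ℕ → Prop) (φ : Pt → ℝ) (a : ℕ) : EReal :=
  Filter.limsup (fun n : ℕ => ((n : ℝ)⁻¹ : EReal) * ENNReal.log (ZnStar M φ a n)) atTop

/-- Strong positive recurrence of `φ`, relative to the common value `P` of the
Gurevich pressure: for some state `a`, `limsup_n (1/n) log Z_n^*(φ,a) < P(φ)`. -/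
def SPR (M : ℕ → ℕ → Prop) (φ : Pt → ℝ) (P : ℝ) : Prop :=
  ∃ a : ℕ, pressureStarAt M φ a < (P : EReal)

/-- The `F`-property: for every state `a` and every `n ≥ 1` there are only finitely
many periodic points of period `n` in `[a]`. -/
def FProperty (M : ℕ → ℕ → Prop) : Prop :=
  ∀ a n : ℕ, 0 < n → (PerSet M a n).Finite

/-- `χ_per(φ) = sup { (1/n) S_n φ(x) : σ^n x = x, n ∈ ℕ }`, with values in `EReal`. -/
noncomputable def chiPer (M : ℕ → ℕ → Prop) (φ : Pt → ℝ) : EReal :=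
  ⨆ p : {p : Pt × ℕ // isAdmissible M p.1 ∧ 0 < p.2 ∧ shiftMap^[p.2] p.1 = p.1},
    ((birkhoff φ p.1.2 p.1.1 / (p.1.2 : ℝ) : ℝ) : EReal)

/-- `x` lies in a cylinder belonging to `B(n, M', q)`: it is admissible,
`x 0 ≤ q`, `x n ≤ q` and `#{0 ≤ k ≤ n : x k ≤ q} ≤ (n+1)/M'`. -/
def inBSet (M : ℕ → ℕ → Prop) (n M' q : ℕ) (x : Pt) : Prop :=
  isAdmissible M x ∧ x 0 ≤ q ∧ x n ≤ q ∧
    ((((Finset.range (n + 1)).filter (fun k => x k ≤ q)).card : ℝ) ≤ (n + 1 : ℝ) / (M' : ℝ))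

/-- `z_{φ,n}(M',q) = sup { (1/n) S_n φ(x) : x ∈ B for some B ∈ B(n,M',q) }`. -/
noncomputable def zPhi (M : ℕ → ℕ → Prop) (φ : Pt → ℝ) (n M' q : ℕ) : EReal :=
  ⨆ x : {x : Pt // inBSet M n M' q x}, ((birkhoff φ n x.1 / (n : ℝ) : ℝ) : EReal)

/-- The contraction at infinity
`δ_{φ,∞} = lim_{q→∞} lim_{M'→∞} limsup_{n→∞} z_{φ,n}(M',q)`
(the inner limits exist by monotonicity, so they agree with `liminf`s). -/
noncomputable def deltaInf (M : ℕ → ℕ → Prop) (φ : Pt → ℝ) : EReal :=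
  liminf (fun q : ℕ => liminf (fun M' : ℕ =>
    limsup (fun n : ℕ => zPhi M φ n M' q) atTop) atTop) atTop

/-- `z_n(M',q) = #B(n,M',q)`, the number of `(n+1)`-cylinders (i.e. admissible
words realized in `Σ`) in `B(n,M',q)`, counted in `ℝ≥0∞`. -/
noncomputable def zCount (M : ℕ → ℕ → Prop) (n M' q : ℕ) : ℝ≥0∞ :=
  ∑' _w : {w : Fin (n + 1) → ℕ //
      (∃ x : Pt, isAdmissible M x ∧ ∀ i : Fin (n + 1), x (i : ℕ) = w i) ∧
      w 0 ≤ q ∧ w (Fin.last n) ≤ q ∧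
      (((Finset.univ.filter (fun i : Fin (n + 1) => w i ≤ q)).card : ℝ) ≤ (n + 1 : ℝ) / (M' : ℝ))},
    (1 : ℝ≥0∞)

/-- The entropy at infinity
`h_∞ = lim_{q→∞} lim_{M'→∞} limsup_{n→∞} (1/n) log z_n(M',q)`. -/
noncomputable def hInfty (M : ℕ → ℕ → Prop) : EReal :=
  liminf (fun q : ℕ => liminf (fun M' : ℕ =>
    limsup (fun n : ℕ => ((n : ℝ)⁻¹ : EReal) * ENNReal.log (zCount M n M' q)) atTop) atTop) atTop

end CMS

namespace CMS

/-- The vertex set of the bouquet graph determined by `a : ℕ → ℕ` (with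
`a 1 ≤ 1`): the root, encoded as `(0,0,0)`, together with the vertices
`v_k^{n,i}` (encoded `(n,i,k)`) for `n ≥ 2`, `1 ≤ i ≤ a n`, `1 ≤ k ≤ n-1`. -/
def BouquetVertex (a : ℕ → ℕ) : Set (ℕ × ℕ × ℕ) :=
  {p | p = (0, 0, 0) ∨
    (2 ≤ p.1 ∧ 1 ≤ p.2.1 ∧ p.2.1 ≤ a p.1 ∧ 1 ≤ p.2.2 ∧ p.2.2 ≤ p.1 - 1)}

/-- The edges of the bouquet graph determined by `a : ℕ → ℕ`: the transitions
along the `a n` disjoint simple loops of length `n` based at the root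
(`a 1 = 1` meaning the self-loop at the root is present). -/
def BouquetEdge (a : ℕ → ℕ) : (ℕ × ℕ × ℕ) → (ℕ × ℕ × ℕ) → Prop := fun u v =>
  (u = (0, 0, 0) ∧ v = (0, 0, 0) ∧ a 1 = 1) ∨
  (u = (0, 0, 0) ∧ ∃ n i : ℕ, 2 ≤ n ∧ 1 ≤ i ∧ i ≤ a n ∧ v = (n, i, 1)) ∨
  (∃ n i k : ℕ, 2 ≤ n ∧ 1 ≤ i ∧ i ≤ a n ∧ 1 ≤ k ∧ k + 1 ≤ n - 1 ∧
    u = (n, i, k) ∧ v = (n, i, k + 1)) ∨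
  (∃ n i : ℕ, 2 ≤ n ∧ 1 ≤ i ∧ i ≤ a n ∧ u = (n, i, n - 1) ∧ v = (0, 0, 0))

/-- The transition matrix `M` on the alphabet `ℕ` is (a presentation of) the
bouquet shift `Σ_V` of `a`, via the enumeration `e` of the vertices with
`e 0` the root.  (All the quantities appearing in our statements are
independent of the chosen enumeration.) -/
def IsBouquet (a : ℕ → ℕ) (M : ℕ → ℕ → Prop) (e : ℕ → ℕ × ℕ × ℕ) : Prop :=
  Function.Injective e ∧ Set.range e = BouquetVertex a ∧ e 0 = (0, 0, 0) ∧
    ∀ u v : ℕ, M u v ↔ BouquetEdge a (e u) (e v)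

end CMS

namespace CMS

/-! ### Exponential growth rates -/

lemma inv_mul_log_ofReal_exp (n : ℕ) (r : ℝ) :
    ((n : ℝ)⁻¹ : EReal) * ENNReal.log (ENNReal.ofReal (Real.exp r)) = ((r / n : ℝ) : EReal) := by
  rw [ENNReal.log_ofReal_of_pos (Real.exp_pos r), Real.log_exp, ← EReal.coe_inv, ← EReal.coe_mul,
    div_eq_inv_mul]

lemma ereal_natCast_inv_nonneg (n : ℕ) : (0 : EReal) ≤ ((n : ℝ)⁻¹ : EReal) := by
  rw [← EReal.coe_inv]
  exact_mod_cast inv_nonneg.2 (Nat.cast_nonneg n)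

lemma limsup_log_le {f : ℕ → ℝ≥0∞} {r : ℕ → ℝ} {κ : ℝ}
    (hr : Tendsto (fun n : ℕ => r n / n) atTop (nhds κ))
    (h : ∀ᶠ n in atTop, f n ≤ ENNReal.ofReal (Real.exp (r n))) :
    limsup (fun n : ℕ => ((n : ℝ)⁻¹ : EReal) * ENNReal.log (f n)) atTop ≤ (κ : EReal) := by
  rw [← (EReal.tendsto_coe.2 hr).limsup_eq]
  refine limsup_le_limsup (h.mono fun n hn => ?_)
  simp only [← inv_mul_log_ofReal_exp]
  exact mul_le_mul_of_nonneg_left (ENNReal.log_monotone hn) (ereal_natCast_inv_nonneg n)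

lemma le_limsup_log {f : ℕ → ℝ≥0∞} {r : ℕ → ℝ} {κ : ℝ}
    (hr : Tendsto (fun n : ℕ => r n / n) atTop (nhds κ))
    (h : ∀ᶠ n in atTop, ENNReal.ofReal (Real.exp (r n)) ≤ f n) :
    (κ : EReal) ≤ limsup (fun n : ℕ => ((n : ℝ)⁻¹ : EReal) * ENNReal.log (f n)) atTop := by
  rw [← (EReal.tendsto_coe.2 hr).limsup_eq]
  refine limsup_le_limsup (h.mono fun n hn => ?_)
  simp only [← inv_mul_log_ofReal_exp]
  exact mul_le_mul_of_nonneg_left (ENNReal.log_monotone hn) (ereal_natCast_inv_nonneg n)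

lemma tendsto_affine_log_div (A B κ : ℝ) :
    Tendsto (fun n : ℕ => (A + n * κ - B * Real.log n) / n) atTop (nhds κ) := by
  have h1 : Tendsto (fun n : ℕ => A / (n : ℝ)) atTop (nhds 0) := tendsto_const_div_atTop_nhds_zero_nat A
  have h2 : Tendsto (fun n : ℕ => Real.log n / (n : ℝ)) atTop (nhds 0) := by
    have := Real.isLittleO_log_id_atTop.tendsto_div_nhds_zero
    exact this.comp tendsto_natCast_atTop_atTop
  have h3 := (h1.add_const κ).sub (h2.const_mul B)
  simp only [zero_add, mul_zero, sub_zero] at h3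
  refine h3.congr' ?_
  filter_upwards [eventually_gt_atTop 0] with n hn
  have : (n : ℝ) ≠ 0 := by positivity
  field_simp

/-! ### Birkhoff sums -/

lemma shiftMap_iterate_apply (k : ℕ) (x : Pt) (j : ℕ) : (shiftMap^[k] x) j = x (j + k) := by
  induction k generalizing j with
  | zero => rfl
  | succ k ih => rw [Function.iterate_succ_apply', shiftMap, ih]; congr 1; omega

lemma isAdmissible.iterate {M : ℕ → ℕ → Prop} {x : Pt} (hx : isAdmissible M x) (k : ℕ) :
    isAdmissible M (shiftMap^[k] x) := fun i => by
  simp only [shiftMap_iterate_apply]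
  convert hx (i + k) using 2; omega

lemma periodic_of_iterate_eq {x : Pt} {n : ℕ} (hx : shiftMap^[n] x = x) (j : ℕ) :
    x (j + n) = x j := by
  rw [← shiftMap_iterate_apply n x j, hx]

lemma birkhoff_eq_sum {M : ℕ → ℕ → Prop} {φ : Pt → ℝ} {ψ : ℕ → ℕ → ℝ}
    (hφ : ∀ x, isAdmissible M x → φ x = ψ (x 0) (x 1)) {x : Pt} (hx : isAdmissible M x) (n : ℕ) :
    birkhoff φ n x = ∑ i ∈ Finset.range n, ψ (x i) (x (i + 1)) := by
  refine Finset.sum_congr rfl fun i _ => ?_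
  rw [hφ _ (hx.iterate i), shiftMap_iterate_apply, shiftMap_iterate_apply, zero_add, add_comm]

lemma sum_le_of_coboundary {M : ℕ → ℕ → Prop} {ψ : ℕ → ℕ → ℝ} {h r : ℕ → ℝ}
    (hψ : ∀ u v, M u v → ψ u v ≤ h u - h v + r u) {x : Pt} (hx : isAdmissible M x) (n : ℕ) :
    ∑ i ∈ Finset.range n, ψ (x i) (x (i + 1)) ≤
      h (x 0) - h (x n) + ∑ i ∈ Finset.range n, r (x i) := by
  induction n with
  | zero => simp
  | succ n ih =>
    rw [Finset.sum_range_succ, Finset.sum_range_succ]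
    linarith [hψ _ _ (hx n)]

/-! ### Weighted sums over paths -/

open Classical in
/-- The total weight of the paths with `n + 1` steps from `u` to `v` whose intermediate
vertices all satisfy `p`. -/
noncomputable def pathSum (W : ℕ → ℕ → ℝ≥0∞) (p : ℕ → Prop) : ℕ → ℕ → ℕ → ℝ≥0∞
  | 0, u, v => W u v
  | n + 1, u, v => ∑' t, if p t then W u t * pathSum W p n t v else 0

lemma tsum_fin_succ_fun (n : ℕ) (F : (Fin (n + 1) → ℕ) → ℝ≥0∞) :
    ∑' w, F w = ∑' t : ℕ, ∑' w : Fin n → ℕ, F (Fin.cons t w) := by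
  rw [← (Fin.consEquiv (fun _ : Fin (n + 1) => ℕ)).tsum_eq]
  exact ENNReal.tsum_prod (f := fun t w => F (Fin.cons t w))

open Classical in
lemma pathSum_eq_tsum_words (W : ℕ → ℕ → ℝ≥0∞) (p : ℕ → Prop) (n u v : ℕ) :
    pathSum W p n u v = ∑' w : Fin n → ℕ, if ∀ i, p (w i) then
      ∏ i : Fin (n + 1), W ((Fin.cons u w : Fin (n + 1) → ℕ) i)
        ((Fin.snoc w v : Fin (n + 1) → ℕ) i) else 0 := by
  induction n generalizing u with
  | zero =>
    rw [pathSum, tsum_eq_single default (fun w hw => absurd (Subsingleton.elim w _) hw)]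
    simp [Fin.snoc]
  | succ n ih =>
    rw [pathSum, tsum_fin_succ_fun]
    refine tsum_congr fun t => ?_
    simp only [Fin.forall_fin_succ, Fin.cons_zero, Fin.cons_succ]
    by_cases ht : p t
    · simp only [ht, true_and, if_true, ih, ← ENNReal.tsum_mul_left]
      refine tsum_congr fun w => ?_
      split_ifs
      · rw [Fin.prod_univ_succ (n := n + 1), ← Fin.cons_snoc_eq_snoc_cons]
        simp only [Fin.cons_zero, Fin.cons_succ]
      · simp
    · simp [ht]

/-- The points of period `n` at `b` whose intermediate vertices all satisfy `p`. -/
def perSetWith (M : ℕ → ℕ → Prop) (p : ℕ → Prop) (b n : ℕ) : Set Pt :=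
  {x | isAdmissible M x ∧ shiftMap^[n] x = x ∧ x 0 = b ∧ ∀ k, 0 < k → k < n → p (x k)}

open Classical in
/-- The weight matrix of a potential depending on two coordinates. -/
noncomputable def weight (M : ℕ → ℕ → Prop) (ψ : ℕ → ℕ → ℝ) (u v : ℕ) : ℝ≥0∞ :=
  if M u v then ENNReal.ofReal (Real.exp (ψ u v)) else 0

lemma cons_shift (x : Pt) (n : ℕ) (i : Fin (n + 1)) :
    (Fin.cons (x 0) (fun j : Fin n => x (j + 1)) : Fin (n + 1) → ℕ) i = x i := by
  refine Fin.cases ?_ (fun i => ?_) i <;> simp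

lemma snoc_shift (x : Pt) (n : ℕ) (i : Fin (n + 1)) :
    (Fin.snoc (fun j : Fin n => x (j + 1)) (x (n + 1)) : Fin (n + 1) → ℕ) i = x (i + 1) := by
  refine Fin.lastCases ?_ (fun i => ?_) i <;> simp

lemma exists_periodic_point {M : ℕ → ℕ → Prop} {n b : ℕ} (w : Fin n → ℕ)
    (hw : ∀ i : Fin (n + 1), M ((Fin.cons b w : Fin (n + 1) → ℕ) i)
      ((Fin.snoc w b : Fin (n + 1) → ℕ) i)) :
    ∃ x : Pt, isAdmissible M x ∧ shiftMap^[n + 1] x = x ∧ x 0 = b ∧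
      ∀ i : Fin n, x (i + 1) = w i := by
  set c : Fin (n + 1) → ℕ := Fin.cons b w with hc
  set x : Pt := fun k => c ⟨k % (n + 1), Nat.mod_lt _ n.succ_pos⟩ with hx
  have hx0 : x 0 = b := by simp [hx, hc, Fin.cons]
  have hxw : ∀ i : Fin n, x (i + 1) = w i := fun i => by
    have : (⟨((i : ℕ) + 1) % (n + 1), Nat.mod_lt _ n.succ_pos⟩ : Fin (n + 1)) = i.succ := by
      ext; simp [Nat.mod_eq_of_lt]
    simp only [hx, this, hc, Fin.cons_succ]
  have hper : ∀ j, x (j + (n + 1)) = x j := fun j => by simp [hx]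
  refine ⟨x, fun k => ?_, ?_, hx0, hxw⟩
  · have h1 := hw ⟨k % (n + 1), Nat.mod_lt _ n.succ_pos⟩
    have h2 : x (n + 1) = b := by rw [← hx0]; simpa using hper 0
    have h3 : w = fun j : Fin n => x (j + 1) := funext fun i => (hxw i).symm
    have h4 : x (k + 1) = x (k % (n + 1) + 1) := by simp [hx]
    rw [h4]
    have h5 := snoc_shift x n ⟨k % (n + 1), Nat.mod_lt _ n.succ_pos⟩
    rw [← h3, h2] at h5
    rw [h5] at h1
    exact h1
  · funext j; rw [shiftMap_iterate_apply, hper]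

lemma tsum_perSetWith {M : ℕ → ℕ → Prop} {φ : Pt → ℝ} {ψ : ℕ → ℕ → ℝ}
    (hφ : ∀ x, isAdmissible M x → φ x = ψ (x 0) (x 1)) (p : ℕ → Prop) (n b : ℕ) :
    ∑' x : perSetWith M p b (n + 1), ENNReal.ofReal (Real.exp (birkhoff φ (n + 1) x.1)) =
      pathSum (weight M ψ) p n b b := by
  classical
  rw [pathSum_eq_tsum_words]
  have hinj : Function.Injective
      (fun (x : perSetWith M p b (n + 1)) (i : Fin n) => x.1 (i + 1)) := by
    intro x y hxy
    obtain ⟨x, hx, hxp, hx0, _⟩ := x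
    obtain ⟨y, hy, hyp, hy0, _⟩ := y
    apply Subtype.ext
    change x = y
    have key : ∀ k < n + 1, x k = y k := fun k hk => by
      rcases k with _ | k
      · rw [hx0, hy0]
      · exact congrFun hxy ⟨k, by omega⟩
    funext k
    induction k using Nat.strong_induction_on with
    | _ k ih =>
      by_cases hk : k < n + 1
      · exact key k hk
      · obtain ⟨j, rfl⟩ : ∃ j, k = j + (n + 1) := ⟨k - (n + 1), by omega⟩
        rw [periodic_of_iterate_eq hxp, periodic_of_iterate_eq hyp]
        exact ih j (by omega)
  rw [← hinj.tsum_eq]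
  · refine tsum_congr fun y => ?_
    obtain ⟨x, hmem⟩ := y
    obtain ⟨hx, hxp, hx0, hxA⟩ := id hmem
    have hxn : x (n + 1) = b := by
      rw [← hx0]; simpa using periodic_of_iterate_eq hxp 0
    have h1 : ∀ i : Fin n, p (x (i + 1)) := fun i => hxA _ (by omega) (by omega)
    rw [if_pos h1, birkhoff_eq_sum hφ hx, Real.exp_sum, ENNReal.ofReal_prod_of_nonneg
      (fun _ _ => (Real.exp_pos _).le), Finset.prod_range]
    refine Finset.prod_congr rfl fun i _ => ?_
    have h2 := cons_shift x n i
    have h3 := snoc_shift x n i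
    rw [hx0] at h2
    rw [hxn] at h3
    rw [h2, h3, weight, if_pos (hx i)]
  · intro w hw
    rw [Function.mem_support] at hw
    split_ifs at hw with hA
    · rw [Finset.prod_ne_zero_iff] at hw
      obtain ⟨x, hx, hxp, hx0, hxw⟩ := exists_periodic_point (M := M) w fun i => by
        by_contra h
        exact hw i (Finset.mem_univ _) (by rw [weight, if_neg h])
      refine ⟨⟨x, hx, hxp, hx0, fun k hk hkn => ?_⟩, funext hxw⟩
      obtain ⟨j, rfl⟩ : ∃ j, k = j + 1 := ⟨k - 1, by omega⟩
      have := hxw ⟨j, by omega⟩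
      simp only at this
      rw [this]
      exact hA _
    · exact absurd rfl hw

lemma Zn_succ_eq_pathSum {M : ℕ → ℕ → Prop} {φ : Pt → ℝ} {ψ : ℕ → ℕ → ℝ}
    (hφ : ∀ x, isAdmissible M x → φ x = ψ (x 0) (x 1)) (n b : ℕ) :
    Zn M φ b (n + 1) = pathSum (weight M ψ) (fun _ => True) n b b := by
  rw [← tsum_perSetWith hφ, Zn]
  have : PerSet M b (n + 1) = perSetWith M (fun _ => True) b (n + 1) := by
    ext x; simp [PerSet, perSetWith]
  rw [this]

lemma ZnStar_succ_eq_pathSum {M : ℕ → ℕ → Prop} {φ : Pt → ℝ} {ψ : ℕ → ℕ → ℝ}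
    (hφ : ∀ x, isAdmissible M x → φ x = ψ (x 0) (x 1)) (n b : ℕ) :
    ZnStar M φ b (n + 1) = pathSum (weight M ψ) (fun t => t ≠ b) n b b := by
  rw [← tsum_perSetWith hφ, ZnStar]
  rfl

lemma ZnStar_le_Zn (M : ℕ → ℕ → Prop) (φ : Pt → ℝ) (b n : ℕ) : ZnStar M φ b n ≤ Zn M φ b n :=
  ENNReal.tsum_mono_subtype (fun x => ENNReal.ofReal (Real.exp (birkhoff φ n x)))
    (show PerStarSet M b n ⊆ PerSet M b n from fun _ hx => ⟨hx.1, hx.2.1, hx.2.2.1⟩)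

lemma pathSum_le_one {W : ℕ → ℕ → ℝ≥0∞} (hW : ∀ u, ∑' t, W u t = 1) (p : ℕ → Prop) (n u v : ℕ) :
    pathSum W p n u v ≤ 1 := by
  induction n generalizing u with
  | zero => exact (ENNReal.le_tsum v).trans (hW u).le
  | succ n ih =>
    rw [pathSum, ← hW u]
    refine ENNReal.tsum_le_tsum fun t => ?_
    split_ifs
    · exact mul_le_of_le_one_right' (ih t)
    · exact zero_le

lemma pathSum_pos {W : ℕ → ℕ → ℝ≥0∞} {p : ℕ → Prop} (n : ℕ) (x : Pt)
    (hx : ∀ i ≤ n, W (x i) (x (i + 1)) ≠ 0) (hp : ∀ i, 0 < i → i ≤ n → p (x i)) :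
    0 < pathSum W p n (x 0) (x (n + 1)) := by
  induction n generalizing x with
  | zero => exact pos_iff_ne_zero.2 (hx 0 le_rfl)
  | succ n ih =>
    rw [pathSum]
    refine lt_of_lt_of_le ?_ (ENNReal.le_tsum (x 1))
    rw [if_pos (hp 1 one_pos (by omega))]
    exact ENNReal.mul_pos (hx 0 (by omega)) (ih (shiftMap x) (fun i hi => hx (i + 1) (by omega))
      (fun i _ hi => hp (i + 1) (by omega) (by omega))).ne'

/-- A subsolution bound on the weighted number of words of length `n + 1` starting at `u`. -/
lemma tsum_words_mul_le {W : ℕ → ℕ → ℝ≥0∞} {V : ℕ → ℝ≥0∞} {θ : ℝ≥0∞}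
    (hW : ∀ u, (∑' t, W u t * V t) * θ ≤ V u) (n u : ℕ) :
    (∑' w : Fin n → ℕ, (∏ i : Fin n, W ((Fin.cons u w : Fin (n + 1) → ℕ) i.castSucc)
      ((Fin.cons u w : Fin (n + 1) → ℕ) i.succ)) *
        V ((Fin.cons u w : Fin (n + 1) → ℕ) (Fin.last n))) * θ ^ n ≤ V u := by
  induction n generalizing u with
  | zero =>
    rw [tsum_eq_single default (fun w hw => absurd (Subsingleton.elim w _) hw)]
    simp
  | succ n ih =>
    refine le_trans ?_ (hW u)
    rw [tsum_fin_succ_fun, pow_succ, ← mul_assoc, ← ENNReal.tsum_mul_right]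
    refine mul_le_mul' (ENNReal.tsum_le_tsum fun t => ?_) le_rfl
    refine le_trans (le_of_eq ?_) (mul_le_mul_right (ih t) (W u t))
    rw [← mul_assoc, ← ENNReal.tsum_mul_left]
    congr 1
    refine tsum_congr fun w => ?_
    rw [Fin.prod_univ_succ, ← mul_assoc]
    simp only [Fin.castSucc_zero, Fin.cons_zero, Fin.cons_succ, ← Fin.succ_castSucc,
      ← Fin.succ_last]

end CMS

namespace CMS

/-! ### Combinatorics of the bouquet graph -/

/-- The number of steps needed to reach the root. -/
def depth (e : ℕ → ℕ × ℕ × ℕ) (u : ℕ) : ℕ := (e u).1 - (e u).2.2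

section Bouquet

variable {a : ℕ → ℕ} {M : ℕ → ℕ → Prop} {e : ℕ → ℕ × ℕ × ℕ}

lemma IsBouquet.apply_eq_root_iff (hb : IsBouquet a M e) {u : ℕ} : e u = (0, 0, 0) ↔ u = 0 := by
  rw [← hb.2.2.1]; exact hb.1.eq_iff

lemma IsBouquet.cases (hb : IsBouquet a M e) {u : ℕ} (hu : u ≠ 0) :
    ∃ n i k, e u = (n, i, k) ∧ 2 ≤ n ∧ 1 ≤ i ∧ i ≤ a n ∧ 1 ≤ k ∧ k ≤ n - 1 := by
  have h : e u ∈ BouquetVertex a := hb.2.1 ▸ mem_range_self u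
  rcases h with h | h
  · exact absurd (hb.apply_eq_root_iff.1 h) hu
  · exact ⟨_, _, _, rfl, h⟩

lemma IsBouquet.exists_vertex (hb : IsBouquet a M e) {n i k : ℕ} (hn : 2 ≤ n) (hi : 1 ≤ i)
    (hia : i ≤ a n) (hk : 1 ≤ k) (hkn : k ≤ n - 1) : ∃ u, e u = (n, i, k) := by
  have : (n, i, k) ∈ range e := by
    rw [hb.2.1]; exact Or.inr ⟨hn, hi, hia, hk, hkn⟩
  exact this

lemma IsBouquet.depth_zero (hb : IsBouquet a M e) : depth e 0 = 0 := by
  simp [depth, hb.2.2.1]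

lemma IsBouquet.depth_pos (hb : IsBouquet a M e) {u : ℕ} (hu : u ≠ 0) : 0 < depth e u := by
  obtain ⟨n, i, k, h, h1, h2, h3, h4, h5⟩ := hb.cases hu
  simp only [depth, h]; omega

lemma IsBouquet.edge_root_iff (hb : IsBouquet a M e) {t : ℕ} :
    M 0 t ↔ (t = 0 ∧ a 1 = 1) ∨ ∃ n i, 2 ≤ n ∧ 1 ≤ i ∧ i ≤ a n ∧ e t = (n, i, 1) := by
  rw [hb.2.2.2, BouquetEdge, hb.2.2.1, hb.apply_eq_root_iff]
  constructor
  · rintro (h | h | ⟨n, i, k, h1, -, -, -, -, h, -⟩ | ⟨n, i, h1, -, -, h, -⟩)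
    · exact Or.inl ⟨h.2.1, h.2.2⟩
    · exact Or.inr h.2
    · simp only [Prod.mk.injEq] at h; omega
    · simp only [Prod.mk.injEq] at h; omega
  · rintro (h | h)
    · exact Or.inl ⟨rfl, h.1, h.2⟩
    · exact Or.inr (Or.inl ⟨rfl, h⟩)

lemma IsBouquet.exists_next (hb : IsBouquet a M e) {u : ℕ} (hu : u ≠ 0) :
    ∃ t, (∀ t', M u t' ↔ t' = t) ∧ depth e u = depth e t + 1 ∧
      (t ≠ 0 → (e t).1 = (e u).1) := by
  obtain ⟨n, i, k, h, h1, h2, h3, h4, h5⟩ := hb.cases hu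
  by_cases hk : k = n - 1
  · refine ⟨0, fun t' => ?_, ?_, fun h => absurd rfl h⟩
    · rw [hb.2.2.2, BouquetEdge, h, hb.apply_eq_root_iff]
      constructor
      · rintro (h' | h' | ⟨n, i, k, g1, -, -, g2, g3, h', -⟩ | ⟨n, i, -, -, -, -, h'⟩)
        · simp only [Prod.mk.injEq] at h'; omega
        · simp only [Prod.mk.injEq] at h'; omega
        · simp only [Prod.mk.injEq] at h'; omega
        · exact h'
      · rintro rfl
        exact Or.inr (Or.inr (Or.inr ⟨n, i, h1, h2, h3, by rw [hk], rfl⟩))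
    · simp only [depth, h, hb.2.2.1]; omega
  · obtain ⟨t, ht⟩ := hb.exists_vertex h1 h2 h3 (show 1 ≤ k + 1 by omega) (by omega)
    refine ⟨t, fun t' => ?_, ?_, fun _ => by rw [h, ht]⟩
    · rw [hb.2.2.2, BouquetEdge, h, ← hb.1.eq_iff (a := t'), ht]
      constructor
      · rintro (h' | h' | ⟨n, i, k, g1, -, -, g2, g3, h', h''⟩ | ⟨n, i, g1, -, -, h', -⟩)
        · simp only [Prod.mk.injEq] at h'; omega
        · simp only [Prod.mk.injEq] at h'; omega
        · simp only [Prod.mk.injEq] at h'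
          rw [h'', h'.1, h'.2.1, h'.2.2]
        · simp only [Prod.mk.injEq] at h'; omega
      · intro h'
        exact Or.inr (Or.inr (Or.inl ⟨n, i, k, h1, h2, h3, h4, by omega, rfl, h'⟩))
    · simp only [depth, h, ht]; omega

/-- A root edge leads to the first vertex of a loop of length one more than its depth. -/
lemma IsBouquet.root_edge_depth (hb : IsBouquet a M e) {t : ℕ} (h : M 0 t) (ht : t ≠ 0) :
    ∃ i, 1 ≤ i ∧ i ≤ a (depth e t + 1) ∧ e t = (depth e t + 1, i, 1) ∧ 1 ≤ depth e t := by
  rcases hb.edge_root_iff.1 h with h | ⟨n, i, hn, hi, hia, h⟩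
  · exact absurd h.1 ht
  · have : depth e t + 1 = n := by simp only [depth, h]; omega
    exact ⟨i, hi, by rwa [this], by rw [this, h], by omega⟩

open Classical in
lemma IsBouquet.tsum_root_edges (hb : IsBouquet a M e) (ha1 : a 1 = 1) (G : ℕ → ℝ≥0∞) :
    (∑' t, if M 0 t then G (depth e t + 1) else 0) = ∑' m, (a (m + 1) : ℝ≥0∞) * G (m + 1) := by
  have hex : ∀ p : Σ m : ℕ, Fin (a (m + 1)), ∃ t, M 0 t ∧ depth e t = p.1 ∧
      (p.1 ≠ 0 → e t = (p.1 + 1, (p.2 : ℕ) + 1, 1)) := by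
    rintro ⟨m, i⟩
    rcases Nat.eq_zero_or_pos m with rfl | hm
    · exact ⟨0, hb.edge_root_iff.2 (Or.inl ⟨rfl, ha1⟩), hb.depth_zero, fun h => absurd rfl h⟩
    · have hi := i.2
      obtain ⟨t, ht⟩ := hb.exists_vertex (n := m + 1) (i := i + 1) (k := 1) (by omega) (by omega)
        (by omega) le_rfl (by omega)
      exact ⟨t, hb.edge_root_iff.2 (Or.inr ⟨_, _, by omega, by omega, by omega, ht⟩),
        by simp [depth, ht], fun _ => ht⟩
  choose s hs1 hs2 hs3 using hex
  have hinj : Function.Injective s := by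
    rintro ⟨m, i⟩ ⟨m', i'⟩ h
    obtain rfl : m = m' := by
      have h1 := hs2 ⟨m, i⟩
      have h2 := hs2 ⟨m', i'⟩
      rw [h] at h1
      exact h1.symm.trans h2
    congr 1
    rcases Nat.eq_zero_or_pos m with rfl | hm
    · have h1 : (i : ℕ) < a 1 := i.2
      have h2 : (i' : ℕ) < a 1 := i'.2
      ext; omega
    · have h1 := hs3 ⟨m, i⟩ hm.ne'
      rw [h, hs3 ⟨m, i'⟩ hm.ne'] at h1
      simp only [Prod.mk.injEq] at h1
      ext; omega
  rw [← hinj.tsum_eq]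
  · rw [ENNReal.tsum_sigma']
    refine tsum_congr fun m => ?_
    simp [hs1, hs2]
  · intro t ht
    have h : M 0 t := by
      by_contra h
      simp [h] at ht
    by_cases h0 : t = 0
    · refine ⟨⟨0, ⟨0, by simp [ha1]⟩⟩, ?_⟩
      by_contra hne
      rw [h0] at hne
      exact (hb.depth_pos hne).ne' (hs2 _)
    · obtain ⟨i, h1, h2, h3, h4⟩ := hb.root_edge_depth h h0
      refine ⟨⟨depth e t, ⟨i - 1, by omega⟩⟩, hb.1 ?_⟩
      rw [hs3 _ (show depth e t ≠ 0 by omega), h3]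
      simp only [Prod.mk.injEq, true_and, and_true]; omega

lemma weight_eq_zero {ψ : ℕ → ℕ → ℝ} {u v : ℕ} (h : ¬ M u v) : weight M ψ u v = 0 := if_neg h

open Classical in
lemma tsum_weight_of_next {ψ : ℕ → ℕ → ℝ} {u t : ℕ} (ht : ∀ t', M u t' ↔ t' = t)
    (hψ : ψ u t = 0) (F : ℕ → ℝ≥0∞) : ∑' t', weight M ψ u t' * F t' = F t := by
  rw [tsum_eq_single t fun t' h => by rw [weight_eq_zero (fun h' => h ((ht t').1 h')), zero_mul],
    weight, if_pos ((ht t).2 rfl), hψ]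
  simp

end Bouquet

end CMS

namespace CMS

/-! ### The first-return weights of the example -/

open Classical in
lemma pathSum_succ (W : ℕ → ℕ → ℝ≥0∞) (p : ℕ → Prop) (n u v : ℕ) :
    pathSum W p (n + 1) u v = ∑' t, W u t * (if p t then pathSum W p n t v else 0) := by
  simp only [pathSum, mul_ite, mul_zero]

/-- A potential charging `log C - log (a m) - β log m` on entering a loop of length `m`. -/
noncomputable def loopPotential (a : ℕ → ℕ) (e : ℕ → ℕ × ℕ × ℕ) (C β : ℝ) (u t : ℕ) : ℝ :=
  if u = 0 then Real.log C - Real.log (a (depth e t + 1)) - β * Real.log ((depth e t + 1 : ℕ) : ℝ)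
  else 0

/-- The total weight of the loops of length `m + 1`. -/
noncomputable def loopMass (C β : ℝ) (m : ℕ) : ℝ≥0∞ := ENNReal.ofReal (C * ((m : ℝ) + 1) ^ (-β))

section Bouquet

variable {a : ℕ → ℕ} {M : ℕ → ℕ → Prop} {e : ℕ → ℕ × ℕ × ℕ} {C β : ℝ}

lemma natCast_mul_loopWeight (hC : 0 < C) (β : ℝ) {k m : ℕ} (hk : 0 < k) :
    (k : ℝ≥0∞) * ENNReal.ofReal (Real.exp (Real.log C - Real.log k - β * Real.log ((m + 1 : ℕ) : ℝ)))
      = loopMass C β m := by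
  have hk' : (0 : ℝ) < k := Nat.cast_pos.2 hk
  rw [loopMass, ← ENNReal.ofReal_natCast, ← ENNReal.ofReal_mul hk'.le, Real.exp_sub, Real.exp_sub,
    Real.exp_log hC, Real.exp_log hk', Real.rpow_def_of_pos (by positivity), mul_neg, Real.exp_neg,
    mul_comm β]
  congr 1
  push_cast
  field_simp

lemma IsBouquet.tsum_weight_root (hb : IsBouquet a M e) (ha1 : a 1 = 1)
    (ha : ∀ m, 0 < a (m + 1)) (hC : 0 < C) (F : ℕ → ℝ≥0∞) :
    ∑' t, weight M (loopPotential a e C β) 0 t * F (depth e t + 1) =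
      ∑' m, loopMass C β m * F (m + 1) := by
  classical
  have := hb.tsum_root_edges ha1 (fun m => ENNReal.ofReal (Real.exp (Real.log C - Real.log (a m) -
    β * Real.log (m : ℝ))) * F m)
  simp only [← mul_assoc, natCast_mul_loopWeight hC β (ha _)] at this
  rw [← this]
  refine tsum_congr fun t => ?_
  simp only [weight, loopPotential, if_true]
  split_ifs <;> simp

lemma IsBouquet.tsum_weight_next (hb : IsBouquet a M e) {u : ℕ} (hu : u ≠ 0) :
    ∃ t, (t ≠ 0 → (e t).1 = (e u).1) ∧ depth e u = depth e t + 1 ∧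
      ∀ F : ℕ → ℝ≥0∞, ∑' t', weight M (loopPotential a e C β) u t' * F t' = F t := by
  obtain ⟨t, h1, h2, h3⟩ := hb.exists_next hu
  exact ⟨t, h3, h2, tsum_weight_of_next h1 (if_neg hu)⟩

lemma tsum_mul_indicator (f : ℕ → ℝ≥0∞) (v : ℕ) : ∑' t, f t * (if t = v then 1 else 0) = f v := by
  simp [tsum_ite_eq]

lemma IsBouquet.tsum_weight (hb : IsBouquet a M e) (ha1 : a 1 = 1) (ha : ∀ m, 0 < a (m + 1))
    (hC : 0 < C) (hmass : ∑' m, loopMass C β m = 1) (u : ℕ) :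
    ∑' t, weight M (loopPotential a e C β) u t = 1 := by
  by_cases hu : u = 0
  · have := hb.tsum_weight_root ha1 ha hC (β := β) (fun _ => 1)
    simp only [mul_one, hmass] at this
    rw [hu, this]
  · obtain ⟨t, -, -, h⟩ := hb.tsum_weight_next (C := C) (β := β) hu
    simpa using h fun _ => 1

lemma IsBouquet.pathSum_taboo_root (hb : IsBouquet a M e) (n : ℕ) {u : ℕ} (hu : u ≠ 0) :
    pathSum (weight M (loopPotential a e C β)) (fun t => t ≠ 0) n u 0 =
      if depth e u = n + 1 then 1 else 0 := by
  induction n generalizing u with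
  | zero =>
    obtain ⟨t, -, h1, h2⟩ := hb.tsum_weight_next (C := C) (β := β) hu
    rw [pathSum, ← tsum_mul_indicator (weight M (loopPotential a e C β) u), h2, h1]
    congr 1
    rw [eq_iff_iff]
    constructor
    · rintro rfl; rw [hb.depth_zero]
    · intro h; by_contra h'
      have := hb.depth_pos h'
      omega
  | succ n ih =>
    obtain ⟨t, -, h1, h2⟩ := hb.tsum_weight_next (C := C) (β := β) hu
    rw [pathSum_succ, h2]
    by_cases ht : t = 0
    · subst ht
      rw [h1, hb.depth_zero]
      simp
    · simp [ht, ih ht, h1]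

lemma IsBouquet.pathSum_root_root (hb : IsBouquet a M e) (ha1 : a 1 = 1)
    (ha : ∀ m, 0 < a (m + 1)) (hC : 0 < C) (n : ℕ) :
    pathSum (weight M (loopPotential a e C β)) (fun t => t ≠ 0) n 0 0 = loopMass C β n := by
  have key : ∑' t, weight M (loopPotential a e C β) 0 t * (if depth e t = n then 1 else 0) =
      loopMass C β n := by
    rw [← tsum_mul_indicator (loopMass C β) n]
    simpa using hb.tsum_weight_root (β := β) ha1 ha hC (fun m => if m = n + 1 then 1 else 0)
  rw [← key]
  cases n with
  | zero =>
    rw [pathSum, ← tsum_mul_indicator (weight M (loopPotential a e C β) 0)]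
    refine tsum_congr fun t => ?_
    congr 2
    rw [eq_iff_iff]
    constructor
    · rintro rfl; exact hb.depth_zero
    · intro h; by_contra h'
      exact (hb.depth_pos h').ne' h
  | succ n =>
    rw [pathSum_succ]
    refine tsum_congr fun t => ?_
    by_cases ht : t = 0
    · subst ht; simp [hb.depth_zero]
    · simp [ht, hb.pathSum_taboo_root n ht]

lemma IsBouquet.tsum_pathSum_eq_top (hb : IsBouquet a M e)
    (hW : ∑' t, weight M (loopPotential a e C β) 0 t = 1) :
    ∑' n, pathSum (weight M (loopPotential a e C β)) (fun _ => True) n 0 0 = ⊤ := by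
  set W := weight M (loopPotential a e C β) with hWdef
  set H : ℕ → ℝ≥0∞ := fun u => ∑' n, pathSum W (fun _ => True) n u 0 with hH
  have hrec : ∀ u, H u = ∑' t, W u t * ((if t = 0 then 1 else 0) + H t) := fun u => by
    simp only [mul_add, hH]
    rw [ENNReal.tsum_add, tsum_mul_indicator, tsum_eq_zero_add' ENNReal.summable, pathSum]
    congr 1
    simp only [pathSum_succ, if_true, ← ENNReal.tsum_mul_left]
    exact ENNReal.tsum_comm
  have hne : ∀ d u, depth e u = d → (if u = 0 then 1 else 0) + H u = 1 + H 0 := fun d => by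
    induction d with
    | zero =>
      intro u hu
      have : u = 0 := by
        by_contra h
        exact (hb.depth_pos h).ne' hu
      simp [this]
    | succ d ih =>
      intro u hu
      have h0 : u ≠ 0 := by
        rintro rfl; rw [hb.depth_zero] at hu; omega
      obtain ⟨t, -, h1, h2⟩ := hb.tsum_weight_next (C := C) (β := β) h0
      rw [if_neg h0, zero_add, hrec, h2, ih t (by omega)]
  have h0 : H 0 = 1 + H 0 := by
    conv_lhs => rw [hrec]
    simp only [hne _ _ rfl, ENNReal.tsum_mul_right, hW, one_mul]
  by_contra h
  have := ENNReal.lt_add_right (a := H 0) h one_ne_zero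
  rw [add_comm, ← h0] at this
  exact lt_irrefl _ this

lemma IsBouquet.pathSum_descend (hb : IsBouquet a M e) {b : ℕ} (hb0 : b ≠ 0) (n d : ℕ) (u : ℕ)
    (hd : depth e u = d) (hu : depth e u ≤ depth e b ∨ (e u).1 ≠ (e b).1) :
    pathSum (weight M (loopPotential a e C β)) (fun t => t ≠ b) (n + d) u b =
      pathSum (weight M (loopPotential a e C β)) (fun t => t ≠ b) n 0 b := by
  induction d generalizing u with
  | zero =>
    have : u = 0 := by
      by_contra h
      exact (hb.depth_pos h).ne' hd
    rw [this, add_zero]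
  | succ d ih =>
    have h0 : u ≠ 0 := by
      rintro rfl; rw [hb.depth_zero] at hd; omega
    obtain ⟨t, h1, h2, h3⟩ := hb.tsum_weight_next (C := C) (β := β) h0
    have htQ : depth e t ≤ depth e b ∨ (e t).1 ≠ (e b).1 := by
      by_cases ht : t = 0
      · left; rw [ht, hb.depth_zero]; omega
      · rcases hu with hu | hu
        · left; omega
        · right; rwa [h1 ht]
    have htb : t ≠ b := by
      rintro rfl
      rcases hu with hu | hu
      · omega
      · exact hu (h1 hb0).symm
    rw [← add_assoc, pathSum_succ, h3, if_pos htb, ih t (by omega) htQ]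

lemma IsBouquet.loopMass_mul_le (hb : IsBouquet a M e) (ha1 : a 1 = 1)
    (ha : ∀ m, 0 < a (m + 1)) (hC : 0 < C) {b : ℕ} (hb0 : b ≠ 0) (k : ℕ) {m : ℕ}
    (hm : (e b).1 ≤ m) :
    loopMass C β m * pathSum (weight M (loopPotential a e C β)) (fun t => t ≠ b) k 0 b ≤
      pathSum (weight M (loopPotential a e C β)) (fun t => t ≠ b) (k + m + 1) 0 b := by
  set W := weight M (loopPotential a e C β) with hW
  have hbn : 2 ≤ (e b).1 := by
    obtain ⟨n, i, j, h, h2, -⟩ := hb.cases hb0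
    rwa [h]
  have key := hb.tsum_weight_root (β := β) ha1 ha hC
    (fun j => if j = m + 1 then pathSum W (fun t => t ≠ b) k 0 b else 0)
  have h1 : loopMass C β m * pathSum W (fun t => t ≠ b) k 0 b ≤ ∑' j, loopMass C β j *
      (if j + 1 = m + 1 then pathSum W (fun t => t ≠ b) k 0 b else 0) := by
    refine le_trans (le_of_eq ?_) (ENNReal.le_tsum m)
    simp
  refine h1.trans (key.symm.le.trans ?_)
  rw [pathSum_succ]
  refine ENNReal.tsum_le_tsum fun t => ?_
  by_cases hM : M 0 t
  · refine mul_le_mul' le_rfl ?_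
    by_cases hd : depth e t = m
    · have ht0 : t ≠ 0 := by
        rintro rfl; rw [hb.depth_zero] at hd; omega
      obtain ⟨i, -, -, h, -⟩ := hb.root_edge_depth hM ht0
      have hne : (e t).1 ≠ (e b).1 := by
        rw [h]; simp only; omega
      have htb : t ≠ b := fun h => hne (by rw [h])
      rw [if_pos (by omega), if_pos htb, hb.pathSum_descend hb0 k m t hd (Or.inr hne)]
    · rw [if_neg (by omega)]
      exact zero_le
  · rw [hW, weight_eq_zero hM, zero_mul]
    exact zero_le

lemma exists_pathSum_root_pos (htrans : TopTransitive M) {b : ℕ}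
    (hb0 : b ≠ 0) :
    ∃ k, 0 < pathSum (weight M (loopPotential a e C β)) (fun t => t ≠ b) k 0 b := by
  classical
  obtain ⟨N, x, hx, hx0, hxN⟩ := htrans 0 b
  have hex : ∃ N, x N = b := ⟨N, hxN⟩
  have hpos : Nat.find hex ≠ 0 := fun h => hb0 (by rw [← Nat.find_spec hex, h, hx0])
  obtain ⟨k, hk⟩ := Nat.exists_eq_succ_of_ne_zero hpos
  refine ⟨k, ?_⟩
  have hxk : x (k + 1) = b := by
    rw [← Nat.succ_eq_add_one, ← hk]; exact Nat.find_spec hex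
  have := pathSum_pos (W := weight M (loopPotential a e C β)) (p := fun t => t ≠ b) k x
    (fun i _ => by
      rw [weight, if_pos (hx i)]
      exact (ENNReal.ofReal_pos.2 (Real.exp_pos _)).ne')
    (fun i _ hi => Nat.find_min hex (by omega))
  rwa [hx0, hxk] at this

/-- First-return partition functions decay at most polynomially at every state. -/
lemma IsBouquet.exists_le_ZnStar (hb : IsBouquet a M e) (ha1 : a 1 = 1)
    (ha : ∀ m, 0 < a (m + 1)) (hC : 0 < C) (hβ : 0 ≤ β) (htrans : TopTransitive M) {φ : Pt → ℝ}
    (hφ : ∀ x, isAdmissible M x → φ x = loopPotential a e C β (x 0) (x 1)) (b : ℕ) :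
    ∃ A : ℝ, ∀ᶠ n : ℕ in atTop,
      ENNReal.ofReal (Real.exp (A + n * 0 - β * Real.log n)) ≤ ZnStar M φ b n := by
  obtain ⟨c, L, N, hc, h⟩ : ∃ (c : ℝ) (L N : ℕ), 0 < c ∧ ∀ m ≥ N,
      loopMass C β m * ENNReal.ofReal c ≤ ZnStar M φ b (m + L + 1) := by
    by_cases hb0 : b = 0
    · refine ⟨1, 0, 0, one_pos, fun m _ => ?_⟩
      rw [add_zero, ZnStar_succ_eq_pathSum hφ, hb0, hb.pathSum_root_root ha1 ha hC]
      simp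
    · obtain ⟨k, hk⟩ := exists_pathSum_root_pos htrans (e := e) (a := a) (C := C) (β := β) hb0
      obtain ⟨c, -, hc, hck⟩ := ENNReal.lt_iff_exists_real_btwn.1 hk
      refine ⟨c, k + 1 + depth e b, (e b).1, ENNReal.ofReal_pos.1 hc, fun m hm => ?_⟩
      rw [ZnStar_succ_eq_pathSum hφ,
        show m + (k + 1 + depth e b) = k + m + 1 + depth e b by ring,
        hb.pathSum_descend hb0 _ _ b rfl (Or.inl le_rfl)]
      exact (mul_le_mul' le_rfl hck.le).trans (hb.loopMass_mul_le ha1 ha hC hb0 k hm)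
  refine ⟨Real.log C + Real.log c, ?_⟩
  filter_upwards [eventually_ge_atTop (N + L + 1)] with n hn
  obtain ⟨m, rfl⟩ : ∃ m, n = m + L + 1 := ⟨n - L - 1, by omega⟩
  refine le_trans ?_ (h m (by omega))
  rw [loopMass, ← ENNReal.ofReal_mul (by positivity)]
  refine ENNReal.ofReal_le_ofReal ?_
  rw [mul_zero, add_zero, Real.exp_sub, Real.exp_add, Real.exp_log hC, Real.exp_log hc,
    Real.rpow_def_of_pos (by positivity), mul_neg, Real.exp_neg, mul_comm β, ← div_eq_mul_inv,
    div_mul_eq_mul_div]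
  refine div_le_div_of_nonneg_left (by positivity) (Real.exp_pos _) (Real.exp_le_exp.2 ?_)
  refine mul_le_mul_of_nonneg_right (Real.log_le_log (by positivity) ?_) hβ
  push_cast
  linarith [(Nat.cast_nonneg L : (0 : ℝ) ≤ L)]

end Bouquet

end CMS

namespace CMS

/-! ### Contraction and entropy at infinity -/

lemma liminf_liminf_le {F : ℕ → ℕ → EReal} {κ : ℕ → ℝ} {κ₀ : ℝ}
    (hκ : Tendsto κ atTop (nhds κ₀)) (h : ∀ q, ∀ᶠ m in atTop, F q m ≤ (κ m : EReal)) :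
    liminf (fun q => liminf (fun m => F q m) atTop) atTop ≤ (κ₀ : EReal) := by
  rw [← liminf_const (f := (atTop : Filter ℕ)) (κ₀ : EReal)]
  refine liminf_le_liminf (Eventually.of_forall fun q => ?_)
  rw [← (EReal.tendsto_coe.2 hκ).liminf_eq]
  exact liminf_le_liminf (h q)

lemma le_liminf_liminf {F : ℕ → ℕ → EReal} {κ₀ : EReal}
    (h : ∀ q, ∀ᶠ m in atTop, κ₀ ≤ F q m) :
    κ₀ ≤ liminf (fun q => liminf (fun m => F q m) atTop) atTop :=
  le_liminf_of_le (by isBoundedDefault) (Eventually.of_forall fun q =>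
    le_liminf_of_le (by isBoundedDefault) (h q))

lemma exists_bound_le (f : ℕ → ℕ) (q : ℕ) : ∃ D, ∀ u ≤ q, f u ≤ D :=
  ⟨(Finset.range (q + 1)).sup f, fun _ hu =>
    Finset.le_sup (f := f) (Finset.mem_range.2 (Nat.lt_succ_of_le hu))⟩

lemma card_filter_fin (x : Pt) (n q : ℕ) :
    (Finset.univ.filter (fun i : Fin n => x i ≤ q)).card =
      ((Finset.range n).filter (fun k => x k ≤ q)).card := by
  simp only [Finset.card_filter, Finset.sum_range]

section Bouquet

variable {a : ℕ → ℕ} {M : ℕ → ℕ → Prop} {e : ℕ → ℕ × ℕ × ℕ} {C β : ℝ}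

/-- The periodic point running around a given loop. -/
lemma IsBouquet.exists_loop (hb : IsBouquet a M e) {n i : ℕ} (hn : 2 ≤ n) (hi : 1 ≤ i)
    (hia : i ≤ a n) : ∃ x : Pt, isAdmissible M x ∧ x 0 = 0 ∧ x n = 0 ∧
      ∀ k, 1 ≤ k → k < n → e (x k) = (n, i, k) := by
  have hex : ∀ k, ∃ u, (k = 0 → u = 0) ∧ (1 ≤ k → k < n → e u = (n, i, k)) := fun k => by
    by_cases hk : 1 ≤ k ∧ k < n
    · obtain ⟨u, hu⟩ := hb.exists_vertex hn hi hia hk.1 (by omega)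
      exact ⟨u, fun h => by omega, fun _ _ => hu⟩
    · exact ⟨0, fun _ => rfl, fun h1 h2 => absurd ⟨h1, h2⟩ hk⟩
  choose v hv0 hv using hex
  refine ⟨fun k => v (k % n), fun k => ?_, hv0 _ (Nat.zero_mod n), hv0 _ (Nat.mod_self n),
    fun k h1 h2 => by simp only [Nat.mod_eq_of_lt h2]; exact hv k h1 h2⟩
  have hr : k % n < n := Nat.mod_lt _ (by omega)
  have hsucc : (k + 1) % n = (k % n + 1) % n := by simp
  simp only [hsucc]
  set r := k % n
  rw [hb.2.2.2]
  by_cases hr0 : r = 0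
  · rw [hr0, zero_add, Nat.mod_eq_of_lt (by omega : 1 < n), hv0 0 rfl, hb.2.2.1,
      hv 1 le_rfl (by omega)]
    exact Or.inr (Or.inl ⟨rfl, n, i, hn, hi, hia, rfl⟩)
  · rw [hv r (by omega) hr]
    by_cases hrn : r + 1 = n
    · rw [hrn, Nat.mod_self, hv0 0 rfl, hb.2.2.1]
      refine Or.inr (Or.inr (Or.inr ⟨n, i, hn, hi, hia, ?_, rfl⟩))
      rw [show r = n - 1 by omega]
    · rw [Nat.mod_eq_of_lt (by omega : r + 1 < n), hv (r + 1) (by omega) (by omega)]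
      exact Or.inr (Or.inr (Or.inl ⟨n, i, r, hn, hi, hia, by omega, by omega, rfl, rfl⟩))

/-- Long loops have few visits to any given finite set of vertices. -/
lemma IsBouquet.eventually_exists_loop (hb : IsBouquet a M e) (m q : ℕ) (hm : 0 < m) :
    ∀ᶠ n in atTop, ∀ i, 1 ≤ i → i ≤ a n → ∃ x : Pt, inBSet M n m q x ∧ x 0 = 0 ∧
      ∀ k, 1 ≤ k → k < n → e (x k) = (n, i, k) := by
  obtain ⟨D, hD⟩ := exists_bound_le (fun u => (e u).1) q
  filter_upwards [eventually_ge_atTop (2 + D + 2 * m)] with n hn i hi hia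
  obtain ⟨x, hx, hx0, hxn, hxk⟩ := hb.exists_loop (by omega) hi hia
  refine ⟨x, ⟨hx, by omega, by omega, ?_⟩, hx0, hxk⟩
  have hsub : (Finset.range (n + 1)).filter (fun k => x k ≤ q) ⊆ {0, n} := fun k hk => by
    simp only [Finset.mem_filter, Finset.mem_range] at hk
    simp only [Finset.mem_insert, Finset.mem_singleton]
    by_contra h
    have h1 := hD _ hk.2
    rw [hxk k (by omega) (by omega)] at h1
    simp only at h1
    omega
  have hcard := (Finset.card_le_card hsub).trans Finset.card_le_two
  have hm' : (0 : ℝ) < m := Nat.cast_pos.2 hm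
  rw [le_div_iff₀ hm']
  have : ((Finset.range (n + 1)).filter (fun k => x k ≤ q)).card * m ≤ n + 1 :=
    (Nat.mul_le_mul_right m hcard).trans (by omega)
  exact_mod_cast this

/-- `loopPotential` is bounded above by a constant up to a coboundary. -/
lemma IsBouquet.loopPotential_le (hb : IsBouquet a M e) (ha1 : a 1 = 1)
    (han : ∀ n, 2 ≤ n → a n = 2 ^ n) (hβ : 0 ≤ β) {c s : ℝ} (hc : c ≤ Real.log 2) (hs : 0 ≤ s)
    (hC : Real.log C ≤ s - c) (hC0 : Real.log C ≤ 0) {u t : ℕ} (h : M u t) :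
    loopPotential a e C β u t ≤
      c * depth e u - c * depth e t + (-c + if u = 0 then s else 0) := by
  by_cases hu : u = 0
  · subst hu
    rw [loopPotential, if_pos rfl, if_pos rfl, hb.depth_zero]
    by_cases ht : t = 0
    · subst ht
      rw [hb.depth_zero, zero_add, ha1]
      simp only [Nat.cast_one, Real.log_one, Nat.cast_zero]
      linarith
    · have hd := hb.depth_pos ht
      rw [han _ (by omega)]
      have h1 : 0 ≤ β * Real.log ((depth e t + 1 : ℕ) : ℝ) :=
        mul_nonneg hβ (Real.log_natCast_nonneg _)
      push_cast at h1 ⊢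
      rw [Real.log_pow]
      have h2 : c * (depth e t + 1 : ℝ) ≤ Real.log 2 * (depth e t + 1 : ℝ) :=
        mul_le_mul_of_nonneg_right hc (by positivity)
      push_cast
      linarith
  · obtain ⟨t', h1, h2, -⟩ := hb.exists_next hu
    obtain rfl := (h1 t).1 h
    rw [loopPotential, if_neg hu, if_neg hu, h2]
    push_cast
    linarith

lemma IsBouquet.birkhoff_le (hb : IsBouquet a M e) (ha1 : a 1 = 1)
    (han : ∀ n, 2 ≤ n → a n = 2 ^ n) (hβ : 0 ≤ β) {c s : ℝ} (hc : c ≤ Real.log 2) (hs : 0 ≤ s)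
    (hC : Real.log C ≤ s - c) (hC0 : Real.log C ≤ 0) {φ : Pt → ℝ}
    (hφ : ∀ x, isAdmissible M x → φ x = loopPotential a e C β (x 0) (x 1)) {x : Pt}
    (hx : isAdmissible M x) (n : ℕ) :
    birkhoff φ n x ≤ c * depth e (x 0) - c * depth e (x n) - n * c +
      s * ((Finset.range n).filter (fun k => x k = 0)).card := by
  rw [birkhoff_eq_sum hφ hx]
  refine (sum_le_of_coboundary (M := M) (h := fun u => c * depth e u)
    (r := fun u => -c + if u = 0 then s else 0) (fun _ _ h => hb.loopPotential_le ha1 han hβ hc hs hC hC0 h)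
    hx n).trans (le_of_eq ?_)
  rw [Finset.sum_add_distrib, Finset.sum_const, Finset.card_range, ← Finset.sum_filter,
    Finset.sum_const, nsmul_eq_mul, nsmul_eq_mul]
  ring

lemma IsBouquet.chiPer_neg (hb : IsBouquet a M e) (ha1 : a 1 = 1)
    (han : ∀ n, 2 ≤ n → a n = 2 ^ n) (hβ : 0 ≤ β) (hC : Real.log C < 0) {φ : Pt → ℝ}
    (hφ : ∀ x, isAdmissible M x → φ x = loopPotential a e C β (x 0) (x 1)) :
    chiPer M φ < (0 : EReal) := by
  set c := min (-Real.log C) (Real.log 2) with hc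
  have hcpos : 0 < c := lt_min (by linarith) (Real.log_pos one_lt_two)
  have hle : chiPer M φ ≤ ((-c : ℝ) : EReal) := by
    refine iSup_le ?_
    rintro ⟨⟨x, n⟩, hx, hn, hxn⟩
    refine EReal.coe_le_coe_iff.2 ?_
    simp only at hx hn hxn ⊢
    have h := hb.birkhoff_le ha1 han hβ (c := c) (s := 0) (min_le_right _ _) le_rfl
      (by linarith [min_le_left (-Real.log C) (Real.log 2)]) hC.le hφ hx n
    have h0 := periodic_of_iterate_eq hxn 0
    rw [zero_add] at h0
    rw [h0] at h
    rw [div_le_iff₀ (by positivity)]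
    linarith
  exact hle.trans_lt (by exact_mod_cast neg_lt_zero.2 hcpos)

lemma IsBouquet.deltaInf_eq (hb : IsBouquet a M e) (ha1 : a 1 = 1)
    (han : ∀ n, 2 ≤ n → a n = 2 ^ n) (hβ : 0 ≤ β) (hC : Real.log C < 0) {φ : Pt → ℝ}
    (hφ : ∀ x, isAdmissible M x → φ x = loopPotential a e C β (x 0) (x 1)) :
    deltaInf M φ = ((-Real.log 2 : ℝ) : EReal) := by
  have hlog2 : 0 < Real.log 2 := Real.log_pos one_lt_two
  refine le_antisymm ?_ ?_
  · refine liminf_liminf_le (κ := fun m : ℕ => -Real.log 2 + Real.log 2 / m) ?_ fun q => ?_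
    · simpa using (tendsto_const_div_atTop_nhds_zero_nat (Real.log 2)).const_add (-Real.log 2)
    · filter_upwards with m
      obtain ⟨D, hD⟩ := exists_bound_le (depth e) q
      have hlim := tendsto_affine_log_div (Real.log 2 * D + Real.log 2 / m) 0
        (-Real.log 2 + Real.log 2 / m)
      rw [← (EReal.tendsto_coe.2 hlim).limsup_eq]
      refine limsup_le_limsup (Eventually.of_forall fun n => iSup_le ?_)
      rintro ⟨x, hx, hx0, hxn, hcard⟩
      refine EReal.coe_le_coe_iff.2 (div_le_div_of_nonneg_right ?_ (Nat.cast_nonneg n))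
      refine (hb.birkhoff_le ha1 han hβ (c := Real.log 2) (s := Real.log 2) le_rfl hlog2.le
        (by linarith) hC.le hφ hx n).trans ?_
      have h1 : (((Finset.range n).filter (fun k => x k = 0)).card : ℝ) ≤ (n + 1 : ℝ) / m := by
        refine le_trans ?_ hcard
        refine Nat.cast_le.2 (Finset.card_le_card fun k hk => ?_)
        simp only [Finset.mem_filter, Finset.mem_range] at hk ⊢
        omega
      have h2 : (depth e (x 0) : ℝ) ≤ D := Nat.cast_le.2 (hD _ hx0)
      have h3 := mul_le_mul_of_nonneg_left h1 hlog2.le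
      have h4 := mul_le_mul_of_nonneg_left h2 hlog2.le
      have h5 : 0 ≤ Real.log 2 * depth e (x n) := by positivity
      have h6 : Real.log 2 * ((n + 1 : ℝ) / m) = n * (Real.log 2 / m) + Real.log 2 / m := by ring
      linarith
  · refine le_liminf_liminf fun q => ?_
    filter_upwards [eventually_gt_atTop 0] with m hm
    have hlim := tendsto_affine_log_div (Real.log C) β (-Real.log 2)
    rw [← (EReal.tendsto_coe.2 hlim).limsup_eq]
    refine limsup_le_limsup ?_
    filter_upwards [hb.eventually_exists_loop m q hm, eventually_ge_atTop 2] with n hn hn2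
    obtain ⟨x, hxB, hx0, hxk⟩ := hn 1 le_rfl (by rw [han n hn2]; exact Nat.one_le_two_pow)
    refine le_trans (EReal.coe_le_coe_iff.2 (le_of_eq ?_))
      (le_iSup (fun x : {x : Pt // inBSet M n m q x} =>
        ((birkhoff φ n x.1 / (n : ℝ) : ℝ) : EReal)) ⟨x, hxB⟩)
    simp only
    congr 1
    rw [birkhoff_eq_sum hφ hxB.1, Finset.sum_eq_single 0]
    · have hd : depth e (x (0 + 1)) + 1 = n := by
        rw [zero_add, depth, hxk 1 le_rfl (by omega)]; simp only; omega
      rw [loopPotential, if_pos hx0, hd, han n hn2]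
      push_cast
      rw [Real.log_pow]
      ring
    · intro k hk hk0
      rw [loopPotential, if_neg]
      intro h
      have := hxk k (by omega) (Finset.mem_range.1 hk)
      rw [h, hb.2.2.1] at this
      simp only [Prod.mk.injEq] at this
      omega
    · intro h
      exact absurd (Finset.mem_range.2 (by omega)) h

lemma IsBouquet.eventually_le_zCount (hb : IsBouquet a M e) (m q : ℕ) (hm : 0 < m) :
    ∀ᶠ n in atTop, (a n : ℝ≥0∞) ≤ zCount M n m q := by
  filter_upwards [hb.eventually_exists_loop m q hm, eventually_ge_atTop 2] with n hn hn2
  choose x hxB hx0 hxk using fun i : Fin (a n) => hn (i + 1) (by omega) (by omega)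
  rw [zCount]
  refine le_trans (le_of_eq ?_) (ENNReal.tsum_comp_le_tsum_of_injective (f := fun i : Fin (a n) =>
    ⟨fun j : Fin (n + 1) => x i j, ⟨x i, (hxB i).1, fun _ => rfl⟩, (hxB i).2.1, (hxB i).2.2.1,
      (card_filter_fin (x i) (n + 1) q).symm ▸ (hxB i).2.2.2⟩) ?_ _)
  · simp
  · intro i j hij
    simp only [Subtype.mk.injEq] at hij
    have h1 := congrFun hij ⟨1, by omega⟩
    simp only at h1
    have h2 := hxk i 1 le_rfl (by omega)
    rw [h1, hxk j 1 le_rfl (by omega)] at h2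
    simp only [Prod.mk.injEq] at h2
    ext; omega

lemma IsBouquet.zCount_mul_le (hb : IsBouquet a M e) (ha1 : a 1 = 1)
    (han : ∀ n, 2 ≤ n → a n = 2 ^ n) {ρ : ℝ} (hρ : 0 < ρ) (hρ1 : ρ < 1) {q D m : ℕ}
    (hm : 0 < m) (hD : ∀ u ≤ q, depth e u ≤ D) (n : ℕ) :
    zCount M n m q * ENNReal.ofReal ((1 - ρ) ^ ((n + 1) / m) * (ρ / 2) ^ (D + n)) ≤
      ENNReal.ofReal (q + 1) := by
  classical
  set s : ℝ≥0∞ := ENNReal.ofReal (1 - ρ) with hs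
  set θ : ℝ≥0∞ := ENNReal.ofReal (ρ / 2) with hθ
  set V : ℕ → ℝ≥0∞ := fun u => θ ^ depth e u with hV
  set W := weight M (fun u _ => if u = 0 then Real.log (1 - ρ) else 0) with hW
  have hs1 : s ≤ 1 := ENNReal.ofReal_le_one.2 (by linarith)
  have hθ1 : θ ≤ 1 := ENNReal.ofReal_le_one.2 (by linarith)
  have hWeq : ∀ u v, M u v → W u v = if u = 0 then s else 1 := fun u v h => by
    rw [hW, weight, if_pos h]
    split_ifs
    · rw [Real.exp_log (by linarith)]
    · simp
  have hsub : ∀ u, (∑' t, W u t * V t) * θ ≤ V u := fun u => by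
    by_cases hu : u = 0
    · subst hu
      have h1 : (∑' t, W 0 t * V t) * θ = ∑' m, (a (m + 1) : ℝ≥0∞) * (s * θ ^ (m + 1)) := by
        rw [← hb.tsum_root_edges ha1 (fun m => s * θ ^ m), ← ENNReal.tsum_mul_right]
        refine tsum_congr fun t => ?_
        split_ifs with h
        · rw [hWeq 0 t h, if_pos rfl, hV, pow_succ, mul_assoc]
        · rw [hW, weight_eq_zero h, zero_mul, zero_mul]
      have h2 : ∀ m, (a (m + 1) : ℝ≥0∞) * (s * θ ^ (m + 1)) ≤ s * ENNReal.ofReal ρ ^ m := by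
        intro m
        have ha2 : a (m + 1) ≤ 2 ^ (m + 1) := by
          rcases Nat.eq_zero_or_pos m with rfl | hm
          · rw [zero_add, ha1]; norm_num
          · exact (han _ (by omega)).le
        calc (a (m + 1) : ℝ≥0∞) * (s * θ ^ (m + 1))
            ≤ ((2 ^ (m + 1) : ℕ) : ℝ≥0∞) * (s * θ ^ (m + 1)) :=
              mul_le_mul' (Nat.cast_le.2 ha2) le_rfl
          _ = s * ENNReal.ofReal ρ ^ (m + 1) := by
              have : (2 : ℝ≥0∞) * θ = ENNReal.ofReal ρ := by
                rw [hθ, ← ENNReal.ofReal_ofNat, ← ENNReal.ofReal_mul zero_le_two]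
                congr 1; ring
              rw [← this, mul_pow]
              push_cast
              ring
          _ ≤ s * ENNReal.ofReal ρ ^ m :=
              mul_le_mul' le_rfl (pow_le_pow_right_of_le_one' (ENNReal.ofReal_le_one.2 hρ1.le)
                (Nat.le_succ m))
      rw [h1, hV]
      simp only [hb.depth_zero, pow_zero]
      refine (ENNReal.tsum_le_tsum h2).trans ?_
      rw [ENNReal.tsum_mul_left, ENNReal.tsum_geometric, ← ENNReal.ofReal_one,
        ← ENNReal.ofReal_sub _ hρ.le, ENNReal.ofReal_one]
      exact ENNReal.mul_inv_le_one _
    · obtain ⟨t, h1, h2, -⟩ := hb.exists_next hu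
      rw [tsum_weight_of_next h1 (if_neg hu), hV]
      simp only [h2, pow_succ, le_refl]
  set F : (Fin (n + 1) → ℕ) → ℝ≥0∞ := fun w =>
    (∏ i : Fin n, W (w i.castSucc) (w i.succ)) * V (w (Fin.last n)) with hF
  have htot : (∑' w : Fin (n + 1) → ℕ, if w 0 ≤ q then F w else 0) * θ ^ n ≤
      ENNReal.ofReal (q + 1) := by
    rw [tsum_fin_succ_fun]
    simp only [Fin.cons_zero]
    rw [← ENNReal.tsum_mul_right]
    have h1 : ∀ t : ℕ, (∑' w : Fin n → ℕ, if t ≤ q then F (Fin.cons t w) else 0) * θ ^ n ≤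
        if t ∈ Finset.range (q + 1) then 1 else 0 := fun t => by
      by_cases ht : t ≤ q
      · simp only [ht, if_true, if_pos (Finset.mem_range.2 (Nat.lt_succ_of_le ht))]
        exact (tsum_words_mul_le hsub n t).trans (pow_le_one' hθ1 _)
      · simp [ht]
    refine (ENNReal.tsum_le_tsum h1).trans (le_of_eq ?_)
    rw [tsum_eq_sum (s := Finset.range (q + 1)) (fun t ht => if_neg ht),
      Finset.sum_congr rfl (fun t ht => if_pos ht), ← Nat.cast_add_one, ENNReal.ofReal_natCast]
    simp
  have hword : ∀ w : Fin (n + 1) → ℕ, (∃ x : Pt, isAdmissible M x ∧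
      ∀ i : Fin (n + 1), x (i : ℕ) = w i) → w (Fin.last n) ≤ q →
      (Finset.univ.filter (fun i : Fin (n + 1) => w i ≤ q)).card ≤ (n + 1) / m →
      s ^ ((n + 1) / m) * θ ^ D ≤ F w := by
    rintro w ⟨x, hx, hxw⟩ hlast hcard
    refine mul_le_mul' ?_ (pow_le_pow_right_of_le_one' hθ1 (hD _ hlast))
    calc s ^ ((n + 1) / m)
        ≤ s ^ (Finset.univ.filter (fun i : Fin (n + 1) => w i ≤ q)).card :=
          pow_le_pow_right_of_le_one' hs1 hcard
      _ = ∏ i : Fin (n + 1), if w i ≤ q then s else 1 := by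
          rw [Finset.prod_ite]; simp
      _ ≤ ∏ i : Fin n, if w i.castSucc ≤ q then s else 1 := by
          rw [Fin.prod_univ_castSucc]
          refine mul_le_of_le_one_right' ?_
          split_ifs <;> simp [hs1]
      _ ≤ ∏ i : Fin n, W (w i.castSucc) (w i.succ) := by
          refine Finset.prod_le_prod' fun i _ => ?_
          have hM : M (w i.castSucc) (w i.succ) := by
            rw [← hxw, ← hxw]; exact hx i
          rw [hWeq _ _ hM]
          by_cases h0 : w i.castSucc = 0
          · simp [h0]
          · rw [if_neg h0]
            split_ifs <;> simp [hs1]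
  have hfac : ENNReal.ofReal ((1 - ρ) ^ ((n + 1) / m) * (ρ / 2) ^ (D + n)) =
      s ^ ((n + 1) / m) * θ ^ D * θ ^ n := by
    rw [ENNReal.ofReal_mul (pow_nonneg (by linarith) _), ENNReal.ofReal_pow (by linarith),
      ENNReal.ofReal_pow (by linarith), pow_add, mul_assoc]
  refine le_trans ?_ htot
  rw [hfac, ← mul_assoc, zCount, ← ENNReal.tsum_mul_right]
  refine mul_le_mul' (le_trans (ENNReal.tsum_le_tsum fun w => ?_)
    (ENNReal.tsum_comp_le_tsum_of_injective Subtype.val_injective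
      (fun w : Fin (n + 1) → ℕ => if w 0 ≤ q then F w else 0))) le_rfl
  obtain ⟨w, hx, hw0, hwl, hcard⟩ := w
  rw [one_mul, if_pos hw0]
  refine hword w hx hwl ((Nat.le_div_iff_mul_le hm).2 ?_)
  rw [le_div_iff₀ (Nat.cast_pos.2 hm)] at hcard
  exact_mod_cast hcard

lemma IsBouquet.hInfty_eq (hb : IsBouquet a M e) (ha1 : a 1 = 1)
    (han : ∀ n, 2 ≤ n → a n = 2 ^ n) : hInfty M = ((Real.log 2 : ℝ) : EReal) := by
  refine le_antisymm ?_ ?_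
  · refine EReal.le_of_forall_lt_iff_le.1 fun z hz => ?_
    have hz' : Real.log 2 < z := EReal.coe_lt_coe_iff.1 hz
    set ρ := Real.exp (Real.log 2 - z) with hρ
    have hρ0 : 0 < ρ := Real.exp_pos _
    have hρ1 : ρ < 1 := (Real.exp_lt_exp.2 (by linarith : Real.log 2 - z < 0)).trans_eq Real.exp_zero
    have hlogρ : Real.log (ρ / 2) = -z := by
      rw [Real.log_div hρ0.ne' two_ne_zero, hρ, Real.log_exp]; ring
    refine liminf_liminf_le (κ := fun m : ℕ => z - Real.log (1 - ρ) / m) ?_ fun q => ?_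
    · simpa using (tendsto_const_div_atTop_nhds_zero_nat (Real.log (1 - ρ))).const_sub z
    · filter_upwards [eventually_gt_atTop 0] with m hm
      obtain ⟨D, hD⟩ := exists_bound_le (depth e) q
      refine limsup_log_le (tendsto_affine_log_div
        (Real.log (q + 1) - Real.log (1 - ρ) / m + D * z) 0 (z - Real.log (1 - ρ) / m))
        (Eventually.of_forall fun n => ?_)
      have h1ρ : 0 < 1 - ρ := by linarith
      have hpos : 0 < (1 - ρ) ^ ((n + 1) / m) * (ρ / 2) ^ (D + n) := by positivity
      have h := hb.zCount_mul_le ha1 han hρ0 hρ1 hm hD n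
      rw [← ENNReal.le_div_iff_mul_le (Or.inl (ENNReal.ofReal_pos.2 hpos).ne')
        (Or.inl ENNReal.ofReal_ne_top), ← ENNReal.ofReal_div_of_pos hpos] at h
      refine h.trans (ENNReal.ofReal_le_ofReal ?_)
      rw [← Real.log_le_iff_le_exp (by positivity), Real.log_div (by positivity) hpos.ne',
        Real.log_mul (by positivity) (by positivity), Real.log_pow, Real.log_pow, hlogρ]
      have hfl : (((n + 1) / m : ℕ) : ℝ) ≤ ((n + 1 : ℕ) : ℝ) / m := Nat.cast_div_le
      have hneg : Real.log (1 - ρ) ≤ 0 := Real.log_nonpos h1ρ.le (by linarith)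
      have h3 := mul_le_mul_of_nonpos_right hfl hneg
      have h4 : ((n + 1 : ℕ) : ℝ) / m * Real.log (1 - ρ) =
          n * (Real.log (1 - ρ) / m) + Real.log (1 - ρ) / m := by push_cast; ring
      rw [h4] at h3
      push_cast
      linarith
  · refine le_liminf_liminf fun q => ?_
    filter_upwards [eventually_gt_atTop 0] with m hm
    refine le_limsup_log (tendsto_affine_log_div 0 0 (Real.log 2)) ?_
    filter_upwards [hb.eventually_le_zCount m q hm, eventually_ge_atTop 2] with n hn hn2
    refine le_trans (le_of_eq ?_) hn
    rw [han n hn2, zero_add, zero_mul, sub_zero, mul_comm, Real.exp_mul, Real.exp_log two_pos,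
      Real.rpow_natCast, ← ENNReal.ofReal_natCast]
    push_cast
    rfl

end Bouquet

end CMS

namespace CMS

lemma summable_natCast_add_one_rpow {s : ℝ} (hs : s < -1) :
    Summable fun n : ℕ => ((n : ℝ) + 1) ^ s := by
  simpa using (summable_nat_add_iff 1).2 (Real.summable_nat_rpow.2 hs)

lemma one_lt_tsum_rpow {β : ℝ} (hβ : 1 < β) : 1 < ∑' n : ℕ, ((n : ℝ) + 1) ^ (-β) := by
  have hsum := summable_natCast_add_one_rpow (s := -β) (by linarith)
  refine lt_of_lt_of_le ?_ (hsum.sum_le_tsum (Finset.range 2) fun _ _ => by positivity)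
  rw [Finset.sum_range_succ, Finset.sum_range_one]
  have : (0 : ℝ) < (((1 : ℕ) : ℝ) + 1) ^ (-β) := by positivity
  simpa using this

lemma tsum_loopMass {C β : ℝ} (hβ : 1 < β) (hC : C = (∑' n : ℕ, ((n : ℝ) + 1) ^ (-β))⁻¹) :
    ∑' m, loopMass C β m = 1 := by
  have hS := one_lt_tsum_rpow hβ
  have hC0 : 0 < C := by rw [hC]; positivity
  simp only [loopMass]
  rw [← ENNReal.ofReal_tsum_of_nonneg (fun n => by positivity)
    ((summable_natCast_add_one_rpow (by linarith)).mul_left C), tsum_mul_left, hC,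
    inv_mul_cancel₀ (by positivity), ENNReal.ofReal_one]

lemma tsum_mul_loopMass_lt_top {C β : ℝ} (hβ : 2 < β) :
    ∑' m : ℕ, ((m + 1 : ℕ) : ℝ≥0∞) * loopMass C β m < ⊤ := by
  have h : ∀ m : ℕ, ((m + 1 : ℕ) : ℝ≥0∞) * loopMass C β m =
      ENNReal.ofReal (C * ((m : ℝ) + 1) ^ (1 - β)) := fun m => by
    rw [loopMass, ← ENNReal.ofReal_natCast, ← ENNReal.ofReal_mul (by positivity), sub_eq_add_neg,
      Real.rpow_add (by positivity), Real.rpow_one]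
    congr 1
    push_cast
    ring
  simp only [h]
  exact ((summable_natCast_add_one_rpow (by linarith)).mul_left C).tsum_ofReal_lt_top

end CMS

open CMS

/-- Section `ssec:eg_not_spr`: sharpness of Theorem `thm:CI-SPR`.
Let `Σ_V` be the bouquet shift with `a 1 = 1` and `a n = 2^n` for `n ≥ 2`.
Fix `β > 2` and `C = 1/ζ(β)` (with `ζ(β) = ∑_{n≥1} n^{-β}`), and let
`φ = log C` on `[r r]`, `φ = log C - n log 2 - β log n` on each `[r v_1^{n,i}]`
(`n ≥ 2`, `1 ≤ i ≤ a n`), and `φ = 0` elsewhere.  Then: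
(i) `P(φ) = 0` and `φ` is positive recurrent;
(ii) `h_∞ = log 2`;
(iii) `δ_{φ,∞} = -log 2`, hence `δ_{φ,∞} + h_∞ = 0 = P(φ)`;
(iv) `Z_1^*(φ,r) = C`, and `Z_n^*(φ,r) = C n^{-β}` for `n ≥ 2`, so
`limsup_n (1/n) log Z_n^*(φ,r) = 0 = P(φ)` and `φ` is not strongly positive
recurrent;
(v) `χ_per(φ) < 0 = P(φ)`, so (UCS) holds. -/
theorem bouquet_not_SPR_example
    (a : ℕ → ℕ) (ha0 : a 0 = 0) (ha1 : a 1 = 1) (han : ∀ n : ℕ, 2 ≤ n → a n = 2 ^ n)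
    (M : ℕ → ℕ → Prop) (e : ℕ → ℕ × ℕ × ℕ)
    (hbq : IsBouquet a M e)
    (htrans : TopTransitive M)
    (β : ℝ) (hβ : 2 < β)
    (C : ℝ) (hC : C = (∑' n : ℕ, ((n : ℝ) + 1) ^ (-β))⁻¹)
    (φ : Pt → ℝ)
    (hrr : ∀ x : Pt, isAdmissible M x →
      e (x 0) = (0, 0, 0) → e (x 1) = (0, 0, 0) → φ x = Real.log C)
    (hrv : ∀ x : Pt, ∀ n i : ℕ, isAdmissible M x → 2 ≤ n → 1 ≤ i → i ≤ a n →
      e (x 0) = (0, 0, 0) → e (x 1) = (n, i, 1) →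
      φ x = Real.log C - (n : ℝ) * Real.log 2 - β * Real.log (n : ℝ))
    (helse : ∀ x : Pt, isAdmissible M x → e (x 0) ≠ (0, 0, 0) → φ x = 0) :
    ((∀ b : ℕ, pressureAt M φ b = (0 : EReal)) ∧
      (∑' n : ℕ, Zn M φ 0 (n + 1)) = ⊤ ∧ (∑' n : ℕ, (n : ℝ≥0∞) * ZnStar M φ 0 n) < ⊤) ∧
    (hInfty M = ((Real.log 2 : ℝ) : EReal)) ∧
    (deltaInf M φ = ((-Real.log 2 : ℝ) : EReal) ∧ deltaInf M φ + hInfty M = (0 : EReal)) ∧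
    (ZnStar M φ 0 1 = ENNReal.ofReal C ∧
      (∀ n : ℕ, 2 ≤ n → ZnStar M φ 0 n = ENNReal.ofReal (C / (n : ℝ) ^ β)) ∧
      pressureStarAt M φ 0 = (0 : EReal) ∧ ¬ SPR M φ 0) ∧
    (chiPer M φ < (0 : EReal)) := by
  have hβ0 : 0 ≤ β := by linarith
  have hS := one_lt_tsum_rpow (β := β) (by linarith)
  have hC0 : 0 < C := by rw [hC]; positivity
  have hC1 : Real.log C < 0 := Real.log_neg hC0 (by rw [hC]; exact inv_lt_one_of_one_lt₀ hS)
  have hapos : ∀ m, 0 < a (m + 1) := fun m => by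
    rcases Nat.eq_zero_or_pos m with rfl | hm
    · rw [zero_add, ha1]; exact one_pos
    · rw [han _ (by omega)]; positivity
  have hφ : ∀ x, isAdmissible M x → φ x = loopPotential a e C β (x 0) (x 1) := fun x hx => by
    by_cases h0 : x 0 = 0
    · rw [loopPotential, if_pos h0]
      have h1 := hx 0
      rw [h0, zero_add] at h1
      by_cases ht : x 1 = 0
      · rw [hrr x hx (hbq.apply_eq_root_iff.2 h0) (hbq.apply_eq_root_iff.2 ht), ht,
          hbq.depth_zero, zero_add, ha1]
        simp
      · obtain ⟨i, hi, hia, h, hd⟩ := hbq.root_edge_depth h1 ht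
        rw [hrv x _ i hx (by omega) hi hia (hbq.apply_eq_root_iff.2 h0) h, han _ (by omega),
          Nat.cast_pow, Real.log_pow, Nat.cast_ofNat]
    · rw [helse x hx (fun h => h0 (hbq.apply_eq_root_iff.1 h)), loopPotential, if_neg h0]
  have hrow := hbq.tsum_weight ha1 hapos hC0 (tsum_loopMass (by linarith) hC)
  have hstar : ∀ m, ZnStar M φ 0 (m + 1) = loopMass C β m := fun m => by
    rw [ZnStar_succ_eq_pathSum hφ, hbq.pathSum_root_root ha1 hapos hC0]
  have hZle : ∀ b, ∀ n : ℕ, 1 ≤ n → Zn M φ b n ≤ 1 := fun b n hn => by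
    obtain ⟨m, rfl⟩ : ∃ m, n = m + 1 := ⟨n - 1, by omega⟩
    rw [Zn_succ_eq_pathSum hφ]
    exact pathSum_le_one hrow _ _ _ _
  have hstar_nonneg : ∀ b, (0 : EReal) ≤ pressureStarAt M φ b := fun b => by
    obtain ⟨A, hA⟩ := hbq.exists_le_ZnStar ha1 hapos hC0 hβ0 htrans hφ b
    exact le_limsup_log (tendsto_affine_log_div A β 0) hA
  have hstar_le : ∀ b, pressureStarAt M φ b ≤ pressureAt M φ b := fun b =>
    limsup_le_limsup (Eventually.of_forall fun n => mul_le_mul_of_nonneg_left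
      (ENNReal.log_monotone (ZnStar_le_Zn M φ b n)) (ereal_natCast_inv_nonneg n))
  have hpress_le : ∀ b, pressureAt M φ b ≤ (0 : EReal) := fun b => by
    refine limsup_log_le (tendsto_affine_log_div 0 0 0) ?_
    filter_upwards [eventually_ge_atTop 1] with n hn
    simpa using hZle b n hn
  have hδ := hbq.deltaInf_eq ha1 han hβ0 hC1 hφ
  have hh := hbq.hInfty_eq ha1 han
  refine ⟨⟨fun b => le_antisymm (hpress_le b) ((hstar_nonneg b).trans (hstar_le b)), ?_, ?_⟩, hh,
    ⟨hδ, ?_⟩, ⟨?_, fun n hn => ?_,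
      le_antisymm ((hstar_le 0).trans (hpress_le 0)) (hstar_nonneg 0), ?_⟩,
    hbq.chiPer_neg ha1 han hβ0 hC1 hφ⟩
  · simp only [Zn_succ_eq_pathSum hφ]
    exact hbq.tsum_pathSum_eq_top (hrow 0)
  · rw [tsum_eq_zero_add' ENNReal.summable, Nat.cast_zero, zero_mul, zero_add]
    simp only [hstar]
    exact tsum_mul_loopMass_lt_top hβ
  · rw [hδ, hh, ← EReal.coe_add, neg_add_cancel, EReal.coe_zero]
  · have := hstar 0
    rw [zero_add] at this
    rw [this, loopMass]
    simp
  · obtain ⟨m, rfl⟩ : ∃ m, n = m + 1 := ⟨n - 1, by omega⟩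
    rw [hstar, loopMass, Real.rpow_neg (by positivity), ← div_eq_mul_inv]
    push_cast
    rfl
  · rintro ⟨b, hb⟩
    exact absurd hb (not_lt.2 (hstar_nonneg b))
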